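/- Let Σ ⊆ ℝ^d be a compact connected set with H^1(Σ) < ∞ that can be covered (up to H^1-null sets) by countably many connected subsets Ξ_1, Ξ_2, ... with Ξ_1 connected and Ξ_{k+1} ∩ (Ξ_1 ∪ ... ∪ Ξ_k) ≠ ∅ for all k. Then for every δ > 0 the Lebesgue measure of the δ-neighborhood satisfies |{x : dist(x, Σ) ≤ δ}| ≤ ω_{d−1}·H^1(Σ)·δ^{d−1} + ω_d·δ^d, where ω_k is the volume of the unit ball of ℝ^k. -/

import Mathlib

open MeasureTheory Metric

/-- The volume `ω_k` of the unit ball of `ℝ^k`. -/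
noncomputable def unitBallVol (k : ℕ) : ℝ :=
  (MeasureTheory.volume (Metric.ball (0 : EuclideanSpace ℝ (Fin k)) 1)).toReal

/-- A connected set containing `p` and a point at distance at least `ρ` from `p` has length at
least `ρ` inside the ball of radius `ρ` around `p`. -/
theorem IsPreconnected.ofReal_le_hausdorffMeasure_inter_ball {X : Type*} [MetricSpace X]
    [MeasurableSpace X] [BorelSpace X] {C : Set X} (hC : IsPreconnected C) {p q : X} (hp : p ∈ C)
    (hq : q ∈ C) {ρ : ℝ} (hρ : ρ ≤ dist q p) :
    ENNReal.ofReal ρ ≤ μH[1] (C ∩ ball p ρ) := by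
  have hsub : Set.Ico 0 ρ ⊆ (fun z => dist z p) '' (C ∩ ball p ρ) := by
    intro s hs
    have himg := (hC.image (fun z => dist z p)
      (continuous_id.dist continuous_const).continuousOn).ordConnected.out
      (Set.mem_image_of_mem _ hp) (Set.mem_image_of_mem _ hq)
    obtain ⟨z, hz, rfl⟩ := himg ⟨by simpa using hs.1, hs.2.le.trans hρ⟩
    exact ⟨z, ⟨hz, hs.2⟩, rfl⟩
  calc ENNReal.ofReal ρ = μH[1] (Set.Ico 0 ρ) := by simp [hausdorffMeasure_real]
    _ ≤ μH[1] ((fun z => dist z p) '' (C ∩ ball p ρ)) := measure_mono hsub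
    _ ≤ μH[1] (C ∩ ball p ρ) := by
      simpa using (LipschitzWith.dist_left p).hausdorffMeasure_image_le zero_le_one (C ∩ ball p ρ)

theorem IsPreconnected.ofReal_dist_le_hausdorffMeasure {X : Type*} [MetricSpace X]
    [MeasurableSpace X] [BorelSpace X] {C : Set X} (hC : IsPreconnected C) {p q : X} (hp : p ∈ C)
    (hq : q ∈ C) : ENNReal.ofReal (dist p q) ≤ μH[1] C :=
  (IsPreconnected.ofReal_le_hausdorffMeasure_inter_ball hC hp hq (dist_comm p q).le).trans
    (measure_mono Set.inter_subset_left)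

/-- `c` is a chain of `n` steps of length less than `ε` in `S` from `x` to `y`. -/
def IsStepChain {X : Type*} [PseudoMetricSpace X] (S : Set X) (ε : ℝ) (x y : X) (n : ℕ)
    (c : ℕ → X) : Prop :=
  c 0 = x ∧ c n = y ∧ (∀ i, c i ∈ S) ∧ ∀ i < n, dist (c i) (c (i + 1)) < ε

theorem IsStepChain.snoc {X : Type*} [PseudoMetricSpace X] {S : Set X} {ε : ℝ} {x y z : X}
    {n : ℕ} {c : ℕ → X} (h : IsStepChain S ε x y n c) (hz : z ∈ S) (hyz : dist y z < ε) :
    IsStepChain S ε x z (n + 1) (fun i => if i ≤ n then c i else z) := by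
  obtain ⟨h0, hn, hS, hd⟩ := h
  refine ⟨by simp [h0], by simp, fun i => by dsimp only; split_ifs <;> simp [*], fun i hi => ?_⟩
  rcases Nat.lt_succ_iff_lt_or_eq.1 hi with h | rfl
  · simpa [h.le, Nat.succ_le_of_lt h] using hd i h
  · simpa [hn] using hyz

theorem IsPreconnected.exists_isStepChain {X : Type*} [PseudoMetricSpace X] {S : Set X}
    (hS : IsPreconnected S) {ε : ℝ} (hε : 0 < ε) {x y : X} (hx : x ∈ S) (hy : y ∈ S) :
    ∃ n c, IsStepChain S ε x y n c := by
  let R : Set X := {z | z ∈ S ∧ ∃ n c, IsStepChain S ε x z n c}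
  have hxR : x ∈ R := ⟨hx, 0, fun _ => x, rfl, rfl, fun _ => hx, fun i hi => by omega⟩
  have hsub : S ⊆ thickening (ε / 2) R := by
    refine hS.subset_of_closure_inter_subset isOpen_thickening
      ⟨x, hx, self_subset_thickening (by positivity) _ hxR⟩ ?_
    rintro z ⟨hz, hzS⟩
    refine self_subset_thickening (by positivity) _ ⟨hzS, ?_⟩
    obtain ⟨w, hw, hzw⟩ := Metric.mem_closure_iff.1 hz (ε / 2) (by positivity)
    obtain ⟨v, ⟨-, n, c, hc⟩, hwv⟩ := mem_thickening_iff.1 hw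
    refine ⟨_, _, hc.snoc hzS ?_⟩
    rw [dist_comm]
    linarith [dist_triangle z w v]
  obtain ⟨v, ⟨-, n, c, hc⟩, hyv⟩ := mem_thickening_iff.1 (hsub hy)
  exact ⟨_, _, hc.snoc hy (by rw [dist_comm]; linarith)⟩

theorem IsStepChain.splice {X : Type*} [PseudoMetricSpace X] {S : Set X} {ε : ℝ} {x y : X}
    {n : ℕ} {c : ℕ → X} (h : IsStepChain S ε x y n c) {i j : ℕ} (hij : i < j) (hj : j ≤ n)
    (hd : dist (c i) (c j) < ε) :
    IsStepChain S ε x y (n - (j - i - 1))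
      (fun k => if k ≤ i then c k else c (k + (j - i - 1))) := by
  obtain ⟨h0, hn, hS, hstep⟩ := h
  refine ⟨by simp [h0], ?_, fun k => by dsimp only; split_ifs <;> apply hS, fun k hk => ?_⟩
  · dsimp only
    rw [if_neg (by omega), ← hn]
    congr 1
    omega
  · rcases lt_trichotomy k i with h | rfl | h
    · simpa [h.le, Nat.succ_le_of_lt h] using hstep k (by omega)
    · simp only [le_refl, if_true]
      rw [if_neg (by omega)]
      convert hd using 3
      omega
    · dsimp only
      rw [if_neg (by omega), if_neg (by omega), add_right_comm]
      exact hstep _ (by omega)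

/-- In a connected set of finite length, step chains can be chosen of controlled total length. -/
theorem IsPreconnected.exists_isStepChain_mul_le {X : Type*} [MetricSpace X]
    [MeasurableSpace X] [BorelSpace X] {S : Set X} (hS : IsPreconnected S) (hSm : MeasurableSet S)
    (hfin : μH[1] S ≠ ⊤) {x y : X} (hx : x ∈ S) (hy : y ∈ S) {ε : ℝ} (hε : 0 < ε)
    (hxy : ε ≤ dist x y) :
    ∃ n c, IsStepChain S ε x y n c ∧ n * ε ≤ 4 * (μH[1] S).toReal := by
  classical
  have hex := hS.exists_isStepChain hε hx hy
  obtain ⟨c, hc⟩ := Nat.find_spec hex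
  have hmin : ∀ m, (∃ c, IsStepChain S ε x y m c) → Nat.find hex ≤ m :=
    fun m hm => Nat.find_min' hex hm
  generalize Nat.find hex = n at hc hmin
  refine ⟨n, c, hc, ?_⟩
  have hsep : ∀ i j, i + 1 < j → j ≤ n → ε ≤ dist (c i) (c j) := by
    intro i j hij hj
    by_contra! h
    have := hmin _ ⟨_, hc.splice (by omega) hj h⟩
    omega
  have hdisj : Set.PairwiseDisjoint (Finset.range (n / 2 + 1) : Set ℕ)
      (fun k => S ∩ ball (c (2 * k)) (ε / 2)) := by
    have key : ∀ k l, k < l → l < n / 2 + 1 →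
        Disjoint (S ∩ ball (c (2 * k)) (ε / 2)) (S ∩ ball (c (2 * l)) (ε / 2)) := by
      intro k l hkl hl
      refine Disjoint.mono Set.inter_subset_right Set.inter_subset_right (ball_disjoint_ball ?_)
      linarith [hsep (2 * k) (2 * l) (by omega) (by omega)]
    intro k hk l hl hkl
    simp only [Finset.coe_range, Set.mem_Iio] at hk hl
    rcases lt_or_gt_of_ne hkl with h | h
    · exact key _ _ h hl
    · exact (key _ _ h hk).symm
  have hball : ∀ k, ENNReal.ofReal (ε / 2) ≤ μH[1] (S ∩ ball (c (2 * k)) (ε / 2)) := by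
    intro k
    rcases le_or_gt (ε / 2) (dist x (c (2 * k))) with h | h
    · exact IsPreconnected.ofReal_le_hausdorffMeasure_inter_ball hS (hc.2.2.1 _) hx h
    · refine IsPreconnected.ofReal_le_hausdorffMeasure_inter_ball hS (hc.2.2.1 _) hy ?_
      linarith [dist_triangle_right x y (c (2 * k))]
  have hsum : (n / 2 + 1 : ℕ) * ENNReal.ofReal (ε / 2) ≤ μH[1] S := by
    calc ((n / 2 + 1 : ℕ) : ENNReal) * ENNReal.ofReal (ε / 2)
        = ∑ k ∈ Finset.range (n / 2 + 1), ENNReal.ofReal (ε / 2) := by simp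
      _ ≤ ∑ k ∈ Finset.range (n / 2 + 1), μH[1] (S ∩ ball (c (2 * k)) (ε / 2)) :=
        Finset.sum_le_sum fun k _ => hball k
      _ = μH[1] (⋃ k ∈ Finset.range (n / 2 + 1), S ∩ ball (c (2 * k)) (ε / 2)) :=
        (measure_biUnion_finset hdisj fun k _ => hSm.inter measurableSet_ball).symm
      _ ≤ μH[1] S := measure_mono (Set.iUnion₂_subset fun k _ => Set.inter_subset_left)
  have hreal := ENNReal.toReal_mono hfin hsum
  rw [ENNReal.toReal_mul, ENNReal.toReal_ofReal (by positivity), ENNReal.toReal_natCast] at hreal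
  have hn : (n : ℝ) ≤ 2 * (n / 2 + 1 : ℕ) := by exact_mod_cast (by omega)
  nlinarith

/-- The curves `[0, 1] → S` (extended arbitrarily to `ℝ`) from `T` to `x` that are `K`-Lipschitz up
to an additive error `η`. -/
def coarseCurves {X : Type*} [PseudoMetricSpace X] (S T : Set X) (x : X) (K η : ℝ) : Set (ℝ → X) :=
  {f | (∀ t, f t ∈ S) ∧ f 0 ∈ T ∧ f 1 = x ∧
    ∀ s ∈ Set.Icc (0 : ℝ) 1, ∀ t ∈ Set.Icc (0 : ℝ) 1, dist (f s) (f t) ≤ K * |s - t| + η}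

theorem coarseCurves_mono {X : Type*} [PseudoMetricSpace X] {S T : Set X} {x : X} {K K' η η' : ℝ}
    (hK : K ≤ K') (hη : η ≤ η') : coarseCurves S T x K η ⊆ coarseCurves S T x K' η' :=
  fun f hf => ⟨hf.1, hf.2.1, hf.2.2.1, fun s hs t ht => (hf.2.2.2 s hs t ht).trans (by gcongr)⟩

theorem isClosed_coarseCurves {X : Type*} [MetricSpace X] {S T : Set X} (hS : IsClosed S)
    (hT : IsClosed T) (x : X) (K η : ℝ) : IsClosed (coarseCurves S T x K η) := by
  simp only [coarseCurves, Set.ofPred_and, Set.ofPred_forall]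
  refine (isClosed_iInter fun t => hS.preimage (continuous_apply t)).inter
    ((hT.preimage (continuous_apply 0)).inter
    ((isClosed_eq (continuous_apply 1) continuous_const).inter
    (isClosed_iInter fun s => isClosed_iInter fun _ => isClosed_iInter fun t =>
      isClosed_iInter fun _ => isClosed_le ?_ continuous_const)))
  exact (continuous_apply s).dist (continuous_apply t)

theorem isCompact_coarseCurves {X : Type*} [MetricSpace X] {S T : Set X} (hS : IsCompact S)
    (hT : IsClosed T) (x : X) (K η : ℝ) : IsCompact (coarseCurves S T x K η) :=
  (isCompact_univ_pi fun _ : ℝ => hS).of_isClosed_subset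
    (isClosed_coarseCurves hS.isClosed hT x K η) fun _ hf t _ => hf.1 t

theorem coarseCurves_nonempty_of_forall_pos {X : Type*} [MetricSpace X] {S T : Set X}
    (hS : IsCompact S) (hT : IsClosed T) {x : X} {K η : ℝ}
    (h : ∀ ε > 0, (coarseCurves S T x (K + ε) (η + ε)).Nonempty) :
    (coarseCurves S T x K η).Nonempty := by
  obtain ⟨f, hf⟩ := IsCompact.nonempty_iInter_of_sequence_nonempty_isCompact_isClosed
    (fun n : ℕ => coarseCurves S T x (K + 1 / (n + 1)) (η + 1 / (n + 1)))
    (fun n => by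
      have : (1 : ℝ) / ((n + 1 : ℕ) + 1) ≤ 1 / (n + 1) := by
        push_cast
        gcongr
        linarith
      exact coarseCurves_mono (by linarith) (by linarith))
    (fun n => h _ (by positivity)) (isCompact_coarseCurves hS hT _ _ _)
    (fun n => isClosed_coarseCurves hS.isClosed hT _ _ _)
  rw [Set.mem_iInter] at hf
  refine ⟨f, (hf 0).1, (hf 0).2.1, (hf 0).2.2.1, fun s hs t ht => ?_⟩
  have hlim : Filter.Tendsto
      (fun n : ℕ => (K + 1 / ((n : ℝ) + 1)) * |s - t| + (η + 1 / ((n : ℝ) + 1)))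
      Filter.atTop (nhds ((K + 0) * |s - t| + (η + 0))) :=
    ((tendsto_one_div_add_atTop_nhds_zero_nat.const_add K).mul_const _).add
      (tendsto_one_div_add_atTop_nhds_zero_nat.const_add η)
  rw [add_zero, add_zero] at hlim
  exact ge_of_tendsto' hlim fun n => (hf n).2.2.2 s hs t ht

/-- Any two points of a compact connected set of finite length are joined by a Lipschitz curve. -/
theorem IsCompact.exists_coarseCurves_nonempty {X : Type*} [MetricSpace X]
    [MeasurableSpace X] [BorelSpace X] {S T : Set X} (hS : IsCompact S) (hSc : IsPreconnected S)
    (hfin : μH[1] S ≠ ⊤) (hT : IsClosed T) {x y : X} (hx : x ∈ S) (hy : y ∈ S) (hyT : y ∈ T)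
    (hxT : x ∉ T) :
    (coarseCurves S T x (4 * (μH[1] S).toReal) 0).Nonempty := by
  refine coarseCurves_nonempty_of_forall_pos hS hT fun ε₀ hε₀ => ?_
  have hyx : 0 < dist y x := dist_pos.2 (fun h => hxT (h ▸ hyT))
  obtain ⟨ε, hε, hεε₀, hεd⟩ : ∃ ε > 0, ε ≤ ε₀ ∧ ε ≤ dist y x :=
    ⟨min ε₀ (dist y x), lt_min hε₀ hyx, min_le_left _ _, min_le_right _ _⟩
  obtain ⟨n, c, ⟨h0, hn, hcS, hstep⟩, hlen⟩ :=
    hSc.exists_isStepChain_mul_le hS.measurableSet hfin hy hx hε hεd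
  have hdist : ∀ i j, i ≤ j → j ≤ n → dist (c i) (c j) ≤ ((j : ℝ) - i) * ε := by
    intro i j hij
    induction j, hij using Nat.le_induction with
    | base => simp
    | succ j hij ih =>
      intro hj
      push_cast
      nlinarith [dist_triangle (c i) (c j) (c (j + 1)), ih (by omega), hstep j (by omega)]
  refine ⟨fun t => c ⌊t * n⌋₊, fun t => hcS _, by simpa [h0] using hyT, by simpa using hn, ?_⟩
  have key : ∀ s ∈ Set.Icc (0 : ℝ) 1, ∀ t ∈ Set.Icc (0 : ℝ) 1, s ≤ t →
      dist (c ⌊s * n⌋₊) (c ⌊t * n⌋₊) ≤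
        (4 * (μH[1] S).toReal + ε₀) * |s - t| + (0 + ε₀) := by
    intro s hs t ht hst
    have hn0 : (0 : ℝ) ≤ n := n.cast_nonneg
    have h1 := hdist ⌊s * n⌋₊ ⌊t * n⌋₊ (Nat.floor_mono (by gcongr))
      (by simpa using Nat.floor_mono (mul_le_mul_of_nonneg_right ht.2 hn0))
    have h2 := Nat.lt_floor_add_one (s * n)
    have h3 := Nat.floor_le (mul_nonneg ht.1 hn0)
    rw [abs_sub_comm, abs_of_nonneg (sub_nonneg.2 hst)]
    have h4 : ((⌊t * n⌋₊ : ℝ) - ⌊s * n⌋₊) * ε ≤ ((t - s) * n + 1) * ε := by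
      gcongr
      linarith
    have h5 : (t - s) * (n * ε) ≤ (t - s) * (4 * (μH[1] S).toReal) := by
      gcongr
    nlinarith [mul_nonneg hε₀.le (sub_nonneg.2 hst)]
  intro s hs t ht
  rcases le_total s t with h | h
  · exact key s hs t ht h
  · rw [dist_comm, abs_sub_comm]
    exact key t ht s hs h

/-- A shortest curve from `T` to `x` is injective and leaves `T` immediately. -/
theorem IsCompact.exists_injOn_curve {X : Type*} [MetricSpace X]
    [MeasurableSpace X] [BorelSpace X] {S T : Set X} (hS : IsCompact S) (hSc : IsPreconnected S)
    (hfin : μH[1] S ≠ ⊤) (hT : IsClosed T) (hTS : T ⊆ S) (hTne : T.Nonempty) {x : X} (hx : x ∈ S)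
    (hxT : x ∉ T) :
    ∃ (K : ℝ) (f : ℝ → X), 0 < K ∧ (∀ t, f t ∈ S) ∧ f 0 ∈ T ∧ f 1 = x ∧
      (∀ s ∈ Set.Icc (0 : ℝ) 1, ∀ t ∈ Set.Icc (0 : ℝ) 1, dist (f s) (f t) ≤ K * |s - t|) ∧
      Set.InjOn f (Set.Icc 0 1) ∧ ∀ t ∈ Set.Ioc (0 : ℝ) 1, f t ∉ T := by
  let A : Set ℝ := {K | (coarseCurves S T x K 0).Nonempty}
  have hApos : ∀ K ∈ A, 0 < K := by
    rintro K ⟨f, hf⟩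
    have h := hf.2.2.2 0 (by simp) 1 (by simp)
    have : 0 < dist (f 0) (f 1) := dist_pos.2 fun h => hxT (hf.2.2.1 ▸ h ▸ hf.2.1)
    norm_num at h
    linarith
  have hAbdd : BddBelow A := ⟨0, fun K hK => (hApos K hK).le⟩
  obtain ⟨y, hy⟩ := hTne
  have hAne : A.Nonempty := ⟨_, hS.exists_coarseCurves_nonempty hSc hfin hT hx (hTS hy) hy hxT⟩
  have hKA : sInf A ∈ A := by
    refine coarseCurves_nonempty_of_forall_pos hS hT fun ε hε => ?_
    obtain ⟨K, hK, hlt⟩ := exists_lt_of_csInf_lt hAne (lt_add_of_pos_right (sInf A) hε)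
    exact hK.mono (coarseCurves_mono hlt.le (by simpa using hε.le))
  have hmin : ∀ K, K < sInf A → ¬ (coarseCurves S T x K 0).Nonempty :=
    fun K hK h => (csInf_le hAbdd h).not_gt hK
  have hKpos := hApos _ hKA
  obtain ⟨f, hfS, hf0, hf1, hf⟩ := hKA
  generalize sInf A = K at *
  simp only [add_zero] at hf
  have hleave : ∀ t ∈ Set.Ioc (0 : ℝ) 1, f t ∉ T := by
    intro t ht htT
    have ht1 : 0 ≤ 1 - t := sub_nonneg.2 ht.2
    refine hmin ((1 - t) * K) (by nlinarith [ht.1]) ⟨fun u => f (t + u * (1 - t)), fun u => hfS _,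
      by simpa using htT, by simpa using hf1, fun u hu v hv => ?_⟩
    have hmem : ∀ w ∈ Set.Icc (0 : ℝ) 1, t + w * (1 - t) ∈ Set.Icc (0 : ℝ) 1 := fun w hw =>
      ⟨by nlinarith [ht.1, hw.1], by nlinarith [hw.2]⟩
    refine (hf _ (hmem u hu) _ (hmem v hv)).trans_eq ?_
    rw [show t + u * (1 - t) - (t + v * (1 - t)) = (1 - t) * (u - v) by ring, abs_mul,
      abs_of_nonneg ht1]
    ring
  have hinj : ∀ s ∈ Set.Icc (0 : ℝ) 1, ∀ t ∈ Set.Icc (0 : ℝ) 1, s < t → f s ≠ f t := by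
    intro s hs t ht hst heq
    have hl0 : 0 ≤ 1 - (t - s) := by linarith [hs.1, ht.2]
    let g : ℝ → X := fun a => if a ≤ s then f a else f (a + (t - s))
    have hg : ∀ a b, 0 ≤ a → a ≤ b → b ≤ 1 - (t - s) → dist (g a) (g b) ≤ K * (b - a) := by
      intro a b ha hab hb
      have hf' : ∀ p q, 0 ≤ p → p ≤ q → q ≤ 1 → dist (f p) (f q) ≤ K * (q - p) := by
        intro p q hp hpq hq
        have := hf p ⟨hp, hpq.trans hq⟩ q ⟨hp.trans hpq, hq⟩
        rwa [abs_sub_comm, abs_of_nonneg (sub_nonneg.2 hpq)] at this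
      by_cases hbs : b ≤ s
      · simp only [g, hbs, hab.trans hbs, if_true]
        exact hf' a b ha hab (hbs.trans hs.2)
      by_cases has : a ≤ s
      · simp only [g, has, hbs, if_true, if_false]
        push Not at hbs
        have h1 := hf' a s ha has hs.2
        have h2 := hf' t (b + (t - s)) ht.1 (by linarith) (by linarith)
        rw [← heq] at h2
        linarith [dist_triangle (f a) (f s) (f (b + (t - s)))]
      · simp only [g, has, hbs, if_false]
        push Not at hbs has
        have := hf' (a + (t - s)) (b + (t - s)) (by linarith) (by linarith) (by linarith)
        linarith
    refine hmin ((1 - (t - s)) * K) (by nlinarith) ⟨fun u => g (u * (1 - (t - s))), fun u => ?_,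
      by simpa [g, hs.1] using hf0, ?_, ?_⟩
    · dsimp only [g]
      split_ifs <;> apply hfS
    · dsimp only [g]
      split_ifs with h
      · obtain rfl : t = 1 := by linarith [ht.2]
        rw [← hf1, ← heq]
        congr 1
        ring
      · rw [← hf1]
        congr 1
        ring
    have key : ∀ u ∈ Set.Icc (0 : ℝ) 1, ∀ v ∈ Set.Icc (0 : ℝ) 1, u ≤ v →
        dist (g (u * (1 - (t - s)))) (g (v * (1 - (t - s)))) ≤
          (1 - (t - s)) * K * |u - v| + 0 := by
      intro u hu v hv huv
      rw [abs_sub_comm, abs_of_nonneg (sub_nonneg.2 huv), add_zero]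
      refine (hg _ _ (mul_nonneg hu.1 hl0) (by gcongr) (by nlinarith [hv.2])).trans_eq ?_
      ring
    intro u hu v hv
    rcases le_total u v with h | h
    · exact key u hu v hv h
    · rw [dist_comm, abs_sub_comm]
      exact key v hv u hu h
  refine ⟨K, f, hKpos, hfS, hf0, hf1, hf, fun s hs t ht h => ?_, hleave⟩
  by_contra hne
  rcases lt_or_gt_of_ne hne with hlt | hlt
  · exact hinj s hs t ht hlt h
  · exact hinj t ht s hs hlt h.symm

theorem volume_ball_eq_unitBallVol {d : ℕ} (x : EuclideanSpace ℝ (Fin d)) {r : ℝ} (hr : 0 < r) :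
    volume (ball x r) = ENNReal.ofReal (unitBallVol d * r ^ d) := by
  rw [Measure.addHaar_ball_of_pos _ _ hr, finrank_euclideanSpace_fin, unitBallVol, mul_comm,
    ENNReal.ofReal_mul ENNReal.toReal_nonneg, ENNReal.ofReal_toReal measure_ball_lt_top.ne]

/-- Translating a ball of radius `r` in `ℝ^(n+1)` by `h` along the first axis sweeps a new region
whose volume is at most `h` times the volume of the `n`-dimensional ball of radius `r`. -/
theorem volume_ball_diff_ball_of_basis {n : ℕ} {h r : ℝ} (hh : 0 ≤ h) (hr : 0 < r) :
    volume (ball (EuclideanSpace.single (0 : Fin (n + 1)) h) r \ ball 0 r) ≤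
      ENNReal.ofReal (unitBallVol n * r ^ n) * ENNReal.ofReal h := by
  let e : EuclideanSpace ℝ (Fin (n + 1)) ≃ᵐ ℝ × EuclideanSpace ℝ (Fin n) :=
    (MeasurableEquiv.toLp 2 (Fin (n + 1) → ℝ)).symm.trans
      ((MeasurableEquiv.piFinSuccAbove (fun _ => ℝ) 0).trans
        ((MeasurableEquiv.refl ℝ).prodCongr (MeasurableEquiv.toLp 2 (Fin n → ℝ))))
  have he : MeasurePreserving e := by
    refine (EuclideanSpace.volume_preserving_symm_measurableEquiv_toLp _).trans
      ((volume_preserving_piFinSuccAbove (fun _ => ℝ) 0).trans ?_)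
    exact (MeasurePreserving.id volume).prod
      (EuclideanSpace.volume_preserving_symm_measurableEquiv_toLp _).symm
  have hnorm : ∀ p : ℝ × EuclideanSpace ℝ (Fin n), ∀ a : ℝ,
      e.symm p ∈ ball (EuclideanSpace.single (0 : Fin (n + 1)) a) r ↔
        (p.1 - a) ^ 2 + ‖p.2‖ ^ 2 < r ^ 2 := by
    intro p a
    rw [mem_ball, dist_eq_norm, ← sq_lt_sq₀ (norm_nonneg _) hr.le, EuclideanSpace.norm_sq_eq,
      EuclideanSpace.norm_sq_eq, Fin.sum_univ_succ]
    have h0 : (e.symm p) 0 = p.1 := rfl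
    have hsucc : ∀ i : Fin n, (e.symm p) i.succ = p.2 i := fun _ => rfl
    simp [h0, hsucc]
  let D : Set (ℝ × EuclideanSpace ℝ (Fin n)) :=
    {p | (p.1 - h) ^ 2 + ‖p.2‖ ^ 2 < r ^ 2 ∧ ¬ p.1 ^ 2 + ‖p.2‖ ^ 2 < r ^ 2}
  have hD : e.symm ⁻¹' (ball (EuclideanSpace.single (0 : Fin (n + 1)) h) r \ ball 0 r) = D := by
    ext p
    have h0 := hnorm p 0
    rw [show EuclideanSpace.single (0 : Fin (n + 1)) (0 : ℝ) = 0 by simp, sub_zero] at h0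
    exact and_congr (hnorm p h) (not_congr h0)
  have hDm : MeasurableSet D := by
    rw [← hD]
    exact e.symm.measurable (measurableSet_ball.diff measurableSet_ball)
  have hslice : ∀ v : EuclideanSpace ℝ (Fin n),
      volume ((fun t => (t, v)) ⁻¹' D) ≤
        (ball (0 : EuclideanSpace ℝ (Fin n)) r).indicator (fun _ => ENNReal.ofReal h) v := by
    intro v
    by_cases hv : ‖v‖ < r
    · rw [Set.indicator_of_mem (by simpa using hv)]
      have hpos : 0 ≤ r ^ 2 - ‖v‖ ^ 2 := by nlinarith [norm_nonneg v]
      obtain ⟨a, ha, hav⟩ : ∃ a : ℝ, 0 ≤ a ∧ a ^ 2 = r ^ 2 - ‖v‖ ^ 2 :=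
        ⟨_, Real.sqrt_nonneg _, Real.sq_sqrt hpos⟩
      have hsub : (fun t : ℝ => (t, v)) ⁻¹' D ⊆ Set.Ico a (a + h) := by
        rintro t ⟨h1, h2⟩
        simp only at h1 h2
        have h3 := abs_lt_of_sq_lt_sq' (show (t - h) ^ 2 < a ^ 2 by linarith) ha
        refine ⟨?_, by linarith⟩
        by_contra! hta
        exact h2 (by nlinarith)
      refine (measure_mono hsub).trans ?_
      simp
    · have hempty : (fun t : ℝ => (t, v)) ⁻¹' D = ∅ := by
        ext t
        simp only [Set.mem_preimage, Set.mem_empty_iff_false, iff_false]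
        rintro ⟨h1, -⟩
        push Not at hv
        simp only at h1
        nlinarith [sq_nonneg (t - h)]
      simp [hempty]
  rw [← he.symm.measure_preimage_equiv, hD, Measure.volume_eq_prod, Measure.prod_apply_symm hDm]
  refine (lintegral_mono hslice).trans_eq ?_
  rw [lintegral_indicator measurableSet_ball, setLIntegral_const, volume_ball_eq_unitBallVol _ hr,
    mul_comm]

theorem volume_ball_diff_ball_le {n : ℕ} (x y : EuclideanSpace ℝ (Fin (n + 1))) {r : ℝ}
    (hr : 0 < r) :
    volume (ball x r \ ball y r) ≤
      ENNReal.ofReal (unitBallVol n * r ^ n) * ENNReal.ofReal (dist x y) := by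
  obtain ⟨b, hb⟩ : ∃ b : OrthonormalBasis (Fin (n + 1)) ℝ (EuclideanSpace ℝ (Fin (n + 1))),
      b.repr (x - y) = EuclideanSpace.single 0 (dist x y) := by
    rcases eq_or_ne x y with rfl | hxy
    · exact ⟨EuclideanSpace.basisFun _ ℝ, by ext i; simp [PiLp.single_apply]⟩
    have hne : ‖x - y‖ ≠ 0 := norm_ne_zero_iff.2 (sub_ne_zero.2 hxy)
    obtain ⟨b, hb⟩ := Orthonormal.exists_orthonormalBasis_extension_of_card_eq (𝕜 := ℝ)
      (E := EuclideanSpace ℝ (Fin (n + 1))) (ι := Fin (n + 1)) (by simp)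
      (v := fun _ => ‖x - y‖⁻¹ • (x - y)) (s := {0}) (by
        rw [orthonormal_iff_ite]
        rintro ⟨i, rfl⟩ ⟨j, rfl⟩
        simp [Set.domRestrict, norm_smul, hne])
    refine ⟨b, ?_⟩
    have h0 : x - y = dist x y • b 0 := by
      rw [hb 0 rfl, dist_eq_norm, smul_smul, mul_inv_cancel₀ hne, one_smul]
    rw [h0, map_smul, b.repr_self]
    ext i
    simp [dist_eq_norm]
  have hpre : (fun z => b.repr (z - y)) ⁻¹'
      (ball (EuclideanSpace.single (0 : Fin (n + 1)) (dist x y)) r \ ball 0 r) =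
        ball x r \ ball y r := by
    ext z
    rw [← hb, Set.mem_preimage, Set.mem_sdiff, Set.mem_sdiff, mem_ball, b.repr.dist_map,
      dist_sub_right, mem_ball, dist_zero_right, b.repr.norm_map, ← dist_eq_norm]
    rfl
  have hmp : MeasurePreserving (fun z => b.repr (z - y)) :=
    b.measurePreserving_repr.comp (measurePreserving_sub_right volume y)
  rw [← hpre, hmp.measure_preimage (measurableSet_ball.diff measurableSet_ball).nullMeasurableSet]
  exact volume_ball_diff_ball_of_basis dist_nonneg hr

/-- Extending an injective curve issuing from `T` adds at least the distance of its endpoints to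
the total length. -/
theorem hausdorffMeasure_union_image_Icc_add_le {X : Type*} [MetricSpace X]
    [MeasurableSpace X] [BorelSpace X] {T : Set X} (hT : IsClosed T) {f : ℝ → X}
    (hf : ContinuousOn f (Set.Icc 0 1)) (hinj : Set.InjOn f (Set.Icc 0 1))
    (hleave : ∀ t ∈ Set.Ioc (0 : ℝ) 1, f t ∉ T) {a b : ℝ} (ha : 0 ≤ a) (hab : a ≤ b) (hb : b ≤ 1) :
    μH[1] (T ∪ f '' Set.Icc 0 a) + ENNReal.ofReal (dist (f a) (f b)) ≤
      μH[1] (T ∪ f '' Set.Icc 0 b) := by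
  have hclosed : IsClosed (T ∪ f '' Set.Icc 0 a) := hT.union
    (isCompact_Icc.image_of_continuousOn
      (hf.mono (Set.Icc_subset_Icc_right (hab.trans hb)))).isClosed
  have hdisj : Disjoint (T ∪ f '' Set.Icc 0 a) (f '' Set.Ioc a b) := by
    rw [Set.disjoint_left]
    rintro _ (hT' | ⟨s, hs, rfl⟩) ⟨t, ht, hst⟩
    · exact hleave t ⟨ha.trans_lt ht.1, ht.2.trans hb⟩ (hst ▸ hT')
    · have := hinj ⟨ha.trans ht.1.le, ht.2.trans hb⟩ ⟨hs.1, hs.2.trans (hab.trans hb)⟩ hst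
      linarith [hs.2, ht.1]
  have hlen : ENNReal.ofReal (dist (f a) (f b)) ≤ μH[1] (f '' Set.Ioc a b) := by
    have : NullSingletonClass (μH[1] : Measure X) :=
      Measure.nullSingletonClass_hausdorff X zero_lt_one
    have hpre := isPreconnected_Icc.image f (hf.mono (Set.Icc_subset_Icc ha hb))
    refine (hpre.ofReal_dist_le_hausdorffMeasure ⟨a, ⟨le_rfl, hab⟩, rfl⟩
      ⟨b, ⟨hab, le_rfl⟩, rfl⟩).trans ?_
    rw [← Set.Ioc_insert_left hab, Set.image_insert_eq, Set.insert_eq]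
    simpa using measure_union_le (μ := μH[1]) {f a} (f '' Set.Ioc a b)
  calc _ ≤ μH[1] (T ∪ f '' Set.Icc 0 a) + μH[1] (f '' Set.Ioc a b) := by gcongr
    _ = μH[1] ((T ∪ f '' Set.Icc 0 a) ∪ f '' Set.Ioc a b) :=
      (measure_union' hdisj hclosed.measurableSet).symm
    _ = μH[1] (T ∪ f '' Set.Icc 0 b) := by
      rw [Set.union_assoc, ← Set.image_union, Set.Icc_union_Ioc_eq_Icc ha hab]

theorem hausdorffMeasure_add_sum_dist_le {X : Type*} [MetricSpace X]
    [MeasurableSpace X] [BorelSpace X] {T : Set X} (hT : IsClosed T) {f : ℝ → X}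
    (hf : ContinuousOn f (Set.Icc 0 1)) (hinj : Set.InjOn f (Set.Icc 0 1))
    (hleave : ∀ t ∈ Set.Ioc (0 : ℝ) 1, f t ∉ T) {N : ℕ} (hN : 0 < N) :
    μH[1] T + ∑ i ∈ Finset.range N,
        ENNReal.ofReal (dist (f ((i : ℝ) / N)) (f (((i + 1 : ℕ) : ℝ) / N))) ≤
      μH[1] (T ∪ f '' Set.Icc 0 1) := by
  have hN' : (0 : ℝ) < N := by exact_mod_cast hN
  have key : ∀ k ≤ N, μH[1] T + ∑ i ∈ Finset.range k,
      ENNReal.ofReal (dist (f ((i : ℝ) / N)) (f (((i + 1 : ℕ) : ℝ) / N))) ≤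
        μH[1] (T ∪ f '' Set.Icc 0 ((k : ℝ) / N)) := by
    intro k
    induction k with
    | zero =>
      intro
      rw [Finset.range_zero, Finset.sum_empty, add_zero]
      exact measure_mono Set.subset_union_left
    | succ k ih =>
      intro hk
      rw [Finset.sum_range_succ, ← add_assoc]
      refine (add_le_add_left (ih (by omega)) _).trans
        (hausdorffMeasure_union_image_Icc_add_le hT hf hinj hleave (by positivity) ?_ ?_)
      · gcongr
        simp
      · rw [div_le_one hN']
        exact_mod_cast hk
  simpa [hN'.ne'] using key N le_rfl

/-- Adding to `T` the points of a chain starting in `T` enlarges the tube of radius `r` by at most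
the length of the chain times the cross-section. -/
theorem volume_thickening_union_chain_le {n : ℕ} {T : Set (EuclideanSpace ℝ (Fin (n + 1)))}
    {p : ℕ → EuclideanSpace ℝ (Fin (n + 1))} (hp : p 0 ∈ T) {r : ℝ} (hr : 0 < r) (N : ℕ) :
    volume (thickening r (T ∪ p '' Set.Iic N)) ≤ volume (thickening r T) +
      ENNReal.ofReal (unitBallVol n * r ^ n) *
        ∑ i ∈ Finset.range N, ENNReal.ofReal (dist (p i) (p (i + 1))) := by
  induction N with
  | zero =>
    rw [Set.union_eq_self_of_subset_right]
    · simp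
    · rintro _ ⟨i, hi, rfl⟩
      rwa [Nat.le_zero.1 hi]
  | succ N ih =>
    have hsub : thickening r (T ∪ p '' Set.Iic (N + 1)) ⊆
        thickening r (T ∪ p '' Set.Iic N) ∪ (ball (p (N + 1)) r \ ball (p N) r) := by
      intro z hz
      by_cases hzN : z ∈ thickening r (T ∪ p '' Set.Iic N)
      · exact Or.inl hzN
      refine Or.inr (Set.mem_sdiff_of_mem ?_ fun h =>
        hzN (mem_thickening_iff.2 ⟨p N, Or.inr ⟨N, Set.self_mem_Iic, rfl⟩, h⟩))
      obtain ⟨w, hw | ⟨i, hi, rfl⟩, hzw⟩ := mem_thickening_iff.1 hz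
      · exact (hzN (mem_thickening_iff.2 ⟨w, Or.inl hw, hzw⟩)).elim
      · rcases Nat.le_succ_iff.1 hi with h | rfl
        · exact (hzN (mem_thickening_iff.2 ⟨p i, Or.inr ⟨i, h, rfl⟩, hzw⟩)).elim
        · exact hzw
    rw [Finset.sum_range_succ, mul_add, ← add_assoc]
    refine (measure_mono hsub).trans ((measure_union_le _ _).trans (add_le_add ih ?_))
    rw [dist_comm]
    exact volume_ball_diff_ball_le _ _ hr

/-- The bound `ω_{n+1} r^{n+1} + ω_n r^n m` for the volume of the tube of radius `r` around a
connected set of length `m` in `ℝ^(n+1)`. -/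
noncomputable def tubeBound (n : ℕ) (m : ENNReal) (r : ℝ) : ENNReal :=
  ENNReal.ofReal (unitBallVol (n + 1) * r ^ (n + 1)) + ENNReal.ofReal (unitBallVol n * r ^ n) * m

theorem continuous_tubeBound (n : ℕ) {m : ENNReal} (hm : m ≠ ⊤) : Continuous (tubeBound n m) := by
  refine (ENNReal.continuous_ofReal.comp (by fun_prop)).add ?_
  exact (ENNReal.continuous_mul_const hm).comp (ENNReal.continuous_ofReal.comp (by fun_prop))

theorem le_tubeBound_of_forall_nat {n : ℕ} {m v : ENNReal} (hm : m ≠ ⊤) {r K : ℝ}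
    (h : ∀ N : ℕ, 0 < N → v ≤ tubeBound n m (r + K / N)) : v ≤ tubeBound n m r := by
  have hlim : Filter.Tendsto (fun N : ℕ => tubeBound n m (r + K / N)) Filter.atTop
      (nhds (tubeBound n m r)) := by
    refine ((continuous_tubeBound n hm).tendsto r).comp ?_
    simpa using (tendsto_const_div_atTop_nhds_zero_nat K).const_add r
  exact ge_of_tendsto hlim (Filter.eventually_atTop.2 ⟨1, fun N hN => h N hN⟩)

/-- The tube estimate for `T` passes to the union of `T` with an injective Lipschitz curve that
meets `T` in its initial point only. -/
theorem volume_thickening_union_curve_le {n : ℕ} {T : Set (EuclideanSpace ℝ (Fin (n + 1)))}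
    (hT : IsClosed T) (hvol : ∀ r > 0, volume (thickening r T) ≤ tubeBound n (μH[1] T) r)
    {f : ℝ → EuclideanSpace ℝ (Fin (n + 1))} {K : ℝ} (hK : 0 < K) (hf0 : f 0 ∈ T)
    (hf : ∀ s ∈ Set.Icc (0 : ℝ) 1, ∀ t ∈ Set.Icc (0 : ℝ) 1, dist (f s) (f t) ≤ K * |s - t|)
    (hcont : ContinuousOn f (Set.Icc 0 1))
    (hinj : Set.InjOn f (Set.Icc 0 1)) (hleave : ∀ t ∈ Set.Ioc (0 : ℝ) 1, f t ∉ T)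
    (hfin : μH[1] (T ∪ f '' Set.Icc 0 1) ≠ ⊤) {r : ℝ} (hr : 0 < r) :
    volume (thickening r (T ∪ f '' Set.Icc 0 1)) ≤
      tubeBound n (μH[1] (T ∪ f '' Set.Icc 0 1)) r := by
  refine le_tubeBound_of_forall_nat (K := K) hfin fun N hN => ?_
  have hN' : (0 : ℝ) < N := by exact_mod_cast hN
  have hr' : 0 < r + K / N := by positivity
  let p : ℕ → EuclideanSpace ℝ (Fin (n + 1)) := fun i => f ((i : ℝ) / N)
  have hsub : thickening r (T ∪ f '' Set.Icc 0 1) ⊆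
      thickening (r + K / N) (T ∪ p '' Set.Iic N) := by
    intro z hz
    obtain ⟨w, hw | ⟨t, ht, rfl⟩, hzw⟩ := mem_thickening_iff.1 hz
    · exact mem_thickening_iff.2 ⟨w, Or.inl hw, hzw.trans (lt_add_of_pos_right _ (by positivity))⟩
    have hle : (⌊t * N⌋₊ : ℝ) ≤ t * N := Nat.floor_le (mul_nonneg ht.1 hN'.le)
    have hlt : t * N < ⌊t * N⌋₊ + 1 := Nat.lt_floor_add_one _
    have hle' : (⌊t * N⌋₊ : ℝ) / N ≤ t := by rwa [div_le_iff₀ hN']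
    refine mem_thickening_iff.2 ⟨p ⌊t * N⌋₊, Or.inr ⟨_, ?_, rfl⟩, ?_⟩
    · have h : (⌊t * N⌋₊ : ℝ) ≤ N := hle.trans (mul_le_of_le_one_left hN'.le ht.2)
      exact Set.mem_Iic.2 (by exact_mod_cast h)
    · have h1 := hf t ht ((⌊t * N⌋₊ : ℝ) / N) ⟨by positivity, hle'.trans ht.2⟩
      rw [abs_of_nonneg (sub_nonneg.2 hle')] at h1
      have h2 : t - (⌊t * N⌋₊ : ℝ) / N ≤ 1 / N := by
        rw [← sub_nonneg]
        have : 1 / (N : ℝ) - (t - ⌊t * N⌋₊ / N) = (⌊t * N⌋₊ + 1 - t * N) / N := by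
          field_simp
          ring
        rw [this]
        exact div_nonneg (by linarith) hN'.le
      have h3 : K * (t - (⌊t * N⌋₊ : ℝ) / N) ≤ K / N := by
        rw [div_eq_mul_one_div K]
        gcongr
      exact (dist_triangle z (f t) _).trans_lt (add_lt_add_of_lt_of_le hzw (h1.trans h3))
  refine (measure_mono hsub).trans ((volume_thickening_union_chain_le (by simpa [p] using hf0) hr'
    N).trans ((add_le_add_left (hvol _ hr') _).trans ?_))
  rw [tubeBound, add_assoc, ← mul_add, tubeBound]
  gcongr
  exact hausdorffMeasure_add_sum_dist_le hT hcont hinj hleave hN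

/-- A compact connected set of finite length is approximated from inside by closed sets satisfying
the tube estimate. -/
theorem IsCompact.exists_subset_thickening_tubeBound {n : ℕ}
    {S : Set (EuclideanSpace ℝ (Fin (n + 1)))} (hS : IsCompact S) (hSc : IsConnected S)
    (hfin : μH[1] S ≠ ⊤) {ε : ℝ} (hε : 0 < ε) :
    ∃ T ⊆ S, S ⊆ thickening ε T ∧
      ∀ r > 0, volume (thickening r T) ≤ tubeBound n (μH[1] T) r := by
  by_contra! hcon
  have key : ∀ k : ℕ, ∃ T ⊆ S, T.Nonempty ∧ IsClosed T ∧ k * ENNReal.ofReal ε ≤ μH[1] T ∧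
      ∀ r > 0, volume (thickening r T) ≤ tubeBound n (μH[1] T) r := by
    intro k
    induction k with
    | zero =>
      obtain ⟨x, hx⟩ := hSc.nonempty
      refine ⟨{x}, by simpa using hx, Set.singleton_nonempty x, isClosed_singleton, by simp,
        fun r hr => ?_⟩
      rw [thickening_singleton, volume_ball_eq_unitBallVol _ hr]
      exact le_self_add
    | succ k ih =>
      obtain ⟨T, hTS, hTne, hT, hlen, hvol⟩ := ih
      have hnot : ¬ S ⊆ thickening ε T := fun h => by
        obtain ⟨r, hr, hlt⟩ := hcon T hTS h
        exact (hvol r hr).not_gt hlt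
      obtain ⟨x, hx, hxT⟩ := Set.not_subset.1 hnot
      obtain ⟨K, f, hK, hfS, hf0, hf1, hf, hinj, hleave⟩ :=
        hS.exists_injOn_curve hSc.isPreconnected hfin hT hTS hTne hx
          fun h => hxT (self_subset_thickening hε _ h)
      have hcont : ContinuousOn f (Set.Icc 0 1) :=
        (LipschitzOnWith.of_dist_le_mul (K := K.toNNReal) fun s hs t ht => by
          simpa [hK.le, Real.dist_eq] using hf s hs t ht).continuousOn
      have hsub : T ∪ f '' Set.Icc 0 1 ⊆ S :=
        Set.union_subset hTS (Set.image_subset_iff.2 fun t _ => hfS t)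
      refine ⟨T ∪ f '' Set.Icc 0 1, hsub, hTne.inl,
        hT.union (isCompact_Icc.image_of_continuousOn hcont).isClosed, ?_, fun r hr =>
        volume_thickening_union_curve_le hT hvol hK hf0 hf hcont hinj hleave
          (measure_ne_top_of_subset hsub hfin) hr⟩
      have hstep := hausdorffMeasure_add_sum_dist_le hT hcont hinj hleave zero_lt_one
      have hdist : ε ≤ dist (f 0) (f 1) := by
        by_contra! h
        rw [dist_comm, hf1] at h
        exact hxT (mem_thickening_iff.2 ⟨_, hf0, h⟩)
      refine le_trans ?_ hstep
      push_cast
      rw [add_mul, one_mul]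
      refine add_le_add hlen ?_
      simpa using ENNReal.ofReal_le_ofReal hdist
  obtain ⟨k, hk⟩ := ENNReal.exists_nat_mul_gt (ENNReal.ofReal_pos.2 hε).ne' hfin
  obtain ⟨T, hTS, -, -, hlen, -⟩ := key k
  exact (hk.trans_le (hlen.trans (measure_mono hTS))).false

/-- Tube estimate for compact connected sets of finite length. -/
theorem IsCompact.volume_infDist_le_le_tubeBound {n : ℕ}
    {S : Set (EuclideanSpace ℝ (Fin (n + 1)))} (hS : IsCompact S) (hSc : IsConnected S)
    (hfin : μH[1] S ≠ ⊤) {δ : ℝ} (hδ : 0 < δ) :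
    volume {x | infDist x S ≤ δ} ≤ tubeBound n (μH[1] S) δ := by
  refine le_tubeBound_of_forall_nat (K := 2) hfin fun N hN => ?_
  have hN' : (0 : ℝ) < 1 / N := one_div_pos.2 (by exact_mod_cast hN)
  obtain ⟨T, hTS, hST, hvol⟩ := hS.exists_subset_thickening_tubeBound hSc hfin hN'
  have hpos : 0 < δ + 2 / N := by positivity
  have hsub : {x | infDist x S ≤ δ} ⊆ thickening (δ + 2 / N) T := by
    intro z hz
    obtain ⟨w, hw, hzw⟩ := (infDist_lt_iff hSc.nonempty).1
      (lt_of_le_of_lt hz (lt_add_of_pos_right δ hN'))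
    obtain ⟨v, hv, hwv⟩ := mem_thickening_iff.1 (hST hw)
    refine mem_thickening_iff.2 ⟨v, hv, (dist_triangle z w v).trans_lt ?_⟩
    rw [show (2 : ℝ) / N = 1 / N + 1 / N by ring]
    linarith
  refine (measure_mono hsub).trans ((hvol _ hpos).trans ?_)
  rw [tubeBound, tubeBound]
  gcongr

/-- Inductive tubular neighborhood estimate (Mosconi–Tilli): if the compact connected set
`S` with finite length is covered, up to `H¹`-null sets, by countably many connected pieces
each touching the union of the previous ones, then the Lebesgue measure of its
`δ`-neighborhood is at most `ω_{d−1} H¹(S) δ^{d−1} + ω_d δ^d`. -/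
theorem stmt10 {d : ℕ} (hd : 1 ≤ d) (S : Set (EuclideanSpace ℝ (Fin d)))
    (hcomp : IsCompact S) (hconn : IsConnected S) (hfin : μH[1] S ≠ ⊤)
    (Ξ : ℕ → Set (EuclideanSpace ℝ (Fin d)))
    (hsub : ∀ k, Ξ k ⊆ S) (hconnΞ : ∀ k, IsConnected (Ξ k))
    (htouch : ∀ k, (Ξ (k + 1) ∩ ⋃ i ≤ k, Ξ i).Nonempty)
    (hcover : μH[1] (S \ ⋃ k, Ξ k) = 0)
    (δ : ℝ) (hδ : 0 < δ) :
    volume {x | Metric.infDist x S ≤ δ} ≤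
      ENNReal.ofReal (unitBallVol (d - 1) * (μH[1] S).toReal * δ ^ (d - 1)
        + unitBallVol d * δ ^ d) := by
  obtain ⟨n, rfl⟩ : ∃ n, d = n + 1 := ⟨d - 1, by omega⟩
  refine (hcomp.volume_infDist_le_le_tubeBound hconn hfin hδ).trans_eq ?_
  have hω : ∀ k, 0 ≤ unitBallVol k := fun k => ENNReal.toReal_nonneg
  have h1 := hω n
  have h2 := hω (n + 1)
  rw [tubeBound, Nat.add_sub_cancel, add_comm, ENNReal.ofReal_add (by positivity) (by positivity)]
  congr 1
  rw [mul_right_comm, ENNReal.ofReal_mul (p := unitBallVol n * δ ^ n) (by positivity),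
    ENNReal.ofReal_toReal hfin]
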